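/- Let G be a connected vertex-transitive non-bipartite triangle-free simple graph of degree 5 and even order that is not 4-factor-critical, and suppose λ₆(G) = λ₇(G) = 14. Then every λ₇-atom S of G satisfies |S| ≥ 14. -/

import Mathlib

open SimpleGraph

section Defs

variable {V : Type*}

/-- A simple graph is vertex-transitive if any vertex can be mapped to any other
by a graph automorphism. -/
def VertexTransitive (G : SimpleGraph V) : Prop :=
  ∀ x y : V, ∃ φ : G ≃g G, φ x = y

/-- A graph is `p`-factor-critical if the removal of any set of `p` vertices
results in a graph with a perfect matching. -/
def PFactorCritical (G : SimpleGraph V) (p : ℕ) : Prop :=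
  ∀ X : Set V, X.ncard = p → ∃ M : (G.induce Xᶜ).Subgraph, M.IsPerfectMatching

/-- A graph is factor-critical if the removal of any single vertex results in a
graph with a perfect matching. -/
def IsFactorCritical {W : Type*} (H : SimpleGraph W) : Prop :=
  ∀ v : W, ∃ M : (H.induce ({v}ᶜ : Set W)).Subgraph, M.IsPerfectMatching

/-- `∇(X)`: the set of edges of `G` with exactly one end in `X`. -/
def edgeBoundary (G : SimpleGraph V) (X : Set V) : Set (Sym2 V) :=
  {e | e ∈ G.edgeSet ∧ ∃ x ∈ X, ∃ y ∈ Xᶜ, e = s(x, y)}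

/-- The set of edges of `G` with both ends in `X`. -/
def edgesWithin (G : SimpleGraph V) (X : Set V) : Set (Sym2 V) :=
  {e | e ∈ G.edgeSet ∧ ∀ v ∈ e, v ∈ X}

/-- The set of edges of `G` with one end in `A` and the other end in `S \ A`
(i.e. the edge boundary of `A` inside the induced subgraph `G[S]` when `A ⊆ S`). -/
def inducedEdgeBoundary (G : SimpleGraph V) (S A : Set V) : Set (Sym2 V) :=
  {e | e ∈ G.edgeSet ∧ ∃ x ∈ A, ∃ y ∈ S \ A, e = s(x, y)}

/-- `F` is an `s`-restricted edge-cut of `G` if deleting `F` disconnects `G` and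
every component of `G − F` has at least `s` vertices. -/
def IsRestrictedEdgeCut (G : SimpleGraph V) (s : ℕ) (F : Set (Sym2 V)) : Prop :=
  F ⊆ G.edgeSet ∧ ¬ (G.deleteEdges F).Connected ∧
    ∀ c : (G.deleteEdges F).ConnectedComponent, s ≤ c.supp.ncard

/-- `λ_s(G)`: the minimum cardinality of an `s`-restricted edge-cut of `G`. -/
noncomputable def lambdaS (G : SimpleGraph V) (s : ℕ) : ℕ :=
  sInf (Set.ncard '' {F | IsRestrictedEdgeCut G s F})

/-- A `λ_s`-fragment: a vertex set whose edge boundary is an `s`-restricted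
edge-cut of minimum cardinality `λ_s(G)`. -/
def IsLambdaFragment (G : SimpleGraph V) (s : ℕ) (X : Set V) : Prop :=
  IsRestrictedEdgeCut G s (edgeBoundary G X) ∧ (edgeBoundary G X).ncard = lambdaS G s

/-- A `λ_s`-atom: a `λ_s`-fragment of minimum cardinality. -/
def IsLambdaAtom (G : SimpleGraph V) (s : ℕ) (X : Set V) : Prop :=
  IsLambdaFragment G s X ∧ ∀ Y : Set V, IsLambdaFragment G s Y → X.ncard ≤ Y.ncard

/-- The odd girth of `G`: the length of a shortest odd cycle of `G`. -/
noncomputable def oddGirth (G : SimpleGraph V) : ℕ :=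
  sInf {n | Odd n ∧ ∃ (v : V) (c : G.Walk v v), c.IsCycle ∧ c.length = n}

/-- `X` is an independent set of `G`. -/
def IsIndependentSet (G : SimpleGraph V) (X : Set V) : Prop :=
  ∀ x ∈ X, ∀ y ∈ X, ¬ G.Adj x y

/-- The independence number `α(G)`. -/
noncomputable def indepNum (G : SimpleGraph V) : ℕ :=
  sSup {n | ∃ X : Set V, IsIndependentSet G X ∧ X.ncard = n}

/-- The number of trivial (single-vertex) components of `G − X`. -/
noncomputable def trivialComponentCount (G : SimpleGraph V) (X : Set V) : ℕ :=
  {c : (G.induce Xᶜ).ConnectedComponent | c.supp.ncard = 1}.ncard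

/-- The number of odd components of `G − X`. -/
noncomputable def oddComponentCount (G : SimpleGraph V) (X : Set V) : ℕ :=
  {c : (G.induce Xᶜ).ConnectedComponent | Odd c.supp.ncard}.ncard

/-- The number of nontrivial components of `G − X`. -/
noncomputable def nontrivialComponentCount (G : SimpleGraph V) (X : Set V) : ℕ :=
  {c : (G.induce Xᶜ).ConnectedComponent | 2 ≤ c.supp.ncard}.ncard

/-- An imprimitive block of `G`: a proper non-empty vertex set that every
automorphism either fixes setwise or maps to a disjoint set. -/
def IsImprimitiveBlock (G : SimpleGraph V) (X : Set V) : Prop :=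
  X.Nonempty ∧ X ≠ Set.univ ∧ ∀ φ : G ≃g G, (⇑φ) '' X = X ∨ ((⇑φ) '' X) ∩ X = ∅

/-- A connected graph is `q`-extendable if it has a perfect matching and every
matching of size `q` is contained in a perfect matching. -/
def Extendable (G : SimpleGraph V) (q : ℕ) : Prop :=
  (∃ M : G.Subgraph, M.IsPerfectMatching) ∧
    ∀ M : G.Subgraph, M.IsMatching → M.edgeSet.ncard = q →
      ∃ P : G.Subgraph, P.IsPerfectMatching ∧ M ≤ P

end Defs

namespace FC

section Count

set_option linter.unusedSectionVars false

variable {V : Type*} [Fintype V] [DecidableEq V] (G : SimpleGraph V) [DecidableRel G.Adj]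

/-- Number of ordered adjacent pairs from `A` to `B`. -/
def eg (A B : Finset V) : ℕ := ∑ a ∈ A, (B.filter (fun b => G.Adj a b)).card

/-- Open neighbourhood of a set. -/
def nb (I : Finset V) : Finset V := I.biUnion (fun v => G.neighborFinset v)

variable {G}

lemma mem_nb {I : Finset V} {w : V} : w ∈ nb G I ↔ ∃ v ∈ I, G.Adj v w := by
  simp [nb]

lemma eg_comm (A B : Finset V) : eg G A B = eg G B A := by
  have := Finset.sum_card_bipartiteAbove_eq_sum_card_bipartiteBelow (s := A) (t := B) G.Adj
  unfold eg
  simp only [Finset.bipartiteAbove, Finset.bipartiteBelow] at this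
  rw [this]
  simp only [G.adj_comm]

lemma eg_union_right {A B C : Finset V} (h : Disjoint B C) :
    eg G A (B ∪ C) = eg G A B + eg G A C := by
  unfold eg
  rw [← Finset.sum_add_distrib]
  refine Finset.sum_congr rfl fun a _ => ?_
  rw [Finset.filter_union, Finset.card_union_of_disjoint]
  exact Finset.disjoint_filter_filter h

lemma eg_union_left {A B C : Finset V} (h : Disjoint B C) :
    eg G (B ∪ C) A = eg G B A + eg G C A := by
  unfold eg
  rw [Finset.sum_union h]

lemma eg_mono_right {A B C : Finset V} (h : B ⊆ C) : eg G A B ≤ eg G A C := by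
  unfold eg
  exact Finset.sum_le_sum fun a _ => Finset.card_le_card (Finset.filter_subset_filter _ h)

lemma eg_eq_zero {A B : Finset V} (h : ∀ a ∈ A, ∀ b ∈ B, ¬ G.Adj a b) : eg G A B = 0 := by
  unfold eg
  refine Finset.sum_eq_zero fun a ha => ?_
  rw [Finset.card_eq_zero, Finset.filter_eq_empty_iff]
  exact fun b hb => h a ha b hb

lemma deg_filter (hreg : G.IsRegularOfDegree 5) (v : V) :
    (Finset.univ.filter (fun b => G.Adj v b)).card = 5 := by
  rw [← hreg v, ← G.card_neighborFinset_eq_degree, G.neighborFinset_eq_filter]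

lemma eg_univ (hreg : G.IsRegularOfDegree 5) (A : Finset V) :
    eg G A Finset.univ = 5 * A.card := by
  unfold eg
  rw [Finset.sum_congr rfl (fun a _ => deg_filter hreg a)]
  simp [mul_comm]

lemma eg_le (hreg : G.IsRegularOfDegree 5) (A B : Finset V) :
    eg G A B ≤ 5 * A.card := by
  rw [← eg_univ hreg]
  exact eg_mono_right (Finset.subset_univ _)

lemma eg_compl (hreg : G.IsRegularOfDegree 5) (A B : Finset V) :
    eg G A B + eg G A Bᶜ = 5 * A.card := by
  rw [← eg_univ hreg, ← eg_union_right disjoint_compl_right, Finset.union_compl]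

lemma eg_nb (hreg : G.IsRegularOfDegree 5) (I : Finset V) :
    eg G I (nb G I) = 5 * I.card := by
  have h := eg_compl hreg I (nb G I)
  rw [eg_eq_zero (A := I) (B := (nb G I)ᶜ)] at h
  · simpa using h
  · intro a ha b hb hab
    rw [Finset.mem_compl, mem_nb] at hb
    exact hb ⟨a, ha, hab⟩

lemma card_le_nb (hreg : G.IsRegularOfDegree 5) (I : Finset V) : I.card ≤ (nb G I).card := by
  have h1 := eg_nb hreg I
  have h2 := eg_le hreg (nb G I) I
  rw [eg_comm] at h2
  omega

lemma five_le_nb (hreg : G.IsRegularOfDegree 5) {I : Finset V} (hI : I.Nonempty) :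
    5 ≤ (nb G I).card := by
  obtain ⟨v, hv⟩ := hI
  rw [← deg_filter hreg v]
  apply Finset.card_le_card
  intro w hw
  rw [mem_nb]
  exact ⟨v, hv, by simpa using hw⟩

lemma nb_union (I J : Finset V) : nb G (I ∪ J) = nb G I ∪ nb G J := by
  ext w; simp only [mem_nb, Finset.mem_union]
  constructor
  · rintro ⟨v, hv | hv, h⟩
    · exact Or.inl ⟨v, hv, h⟩
    · exact Or.inr ⟨v, hv, h⟩
  · rintro (⟨v, hv, h⟩ | ⟨v, hv, h⟩)
    · exact ⟨v, Or.inl hv, h⟩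
    · exact ⟨v, Or.inr hv, h⟩

lemma nb_inter (I J : Finset V) : nb G (I ∩ J) ⊆ nb G I ∩ nb G J := by
  intro w
  simp only [mem_nb, Finset.mem_inter]
  rintro ⟨v, ⟨h1, h2⟩, h⟩
  exact ⟨⟨v, h1, h⟩, ⟨v, h2, h⟩⟩

/-- Submodularity of the neighbourhood size. -/
lemma nb_submod (I J : Finset V) :
    (nb G (I ∩ J)).card + (nb G (I ∪ J)).card ≤ (nb G I).card + (nb G J).card := by
  rw [nb_union]
  have h1 := Finset.card_le_card (nb_inter (G := G) I J)
  have h2 := Finset.card_union_add_card_inter (nb G I) (nb G J)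
  omega

lemma nb_image (φ : G ≃g G) (I : Finset V) : nb G (I.image φ) = (nb G I).image φ := by
  ext w
  simp only [mem_nb, Finset.mem_image]
  constructor
  · rintro ⟨v, ⟨u, hu, rfl⟩, h⟩
    refine ⟨φ.symm w, ⟨u, hu, ?_⟩, by simp⟩
    rw [← φ.map_adj_iff]; simpa using h
  · rintro ⟨x, ⟨u, hu, h⟩, rfl⟩
    exact ⟨φ u, ⟨u, hu, rfl⟩, φ.map_adj_iff.2 h⟩

lemma card_nb_image (φ : G ≃g G) (I : Finset V) :
    (nb G (I.image φ)).card = (nb G I).card := by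
  rw [nb_image, Finset.card_image_of_injective _ φ.injective]

/-- A nonempty vertex set closed under adjacency in a connected graph is everything. -/
lemma closed_eq_univ (hconn : G.Connected) {A : Finset V} (hne : A.Nonempty)
    (hcl : ∀ v ∈ A, ∀ w, G.Adj v w → w ∈ A) : A = Finset.univ := by
  obtain ⟨a, ha⟩ := hne
  rw [Finset.eq_univ_iff_forall]
  intro x
  obtain ⟨p⟩ := hconn.preconnected a x
  induction p with
  | nil => exact ha
  | cons h p ih => exact ih (hcl _ ha _ h)

/-- In a non-bipartite graph, nontrivial sets have a larger neighbourhood. -/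
lemma nb_ne (hreg : G.IsRegularOfDegree 5) (hconn : G.Connected) (hnb : ¬ G.Colorable 2)
    {I : Finset V} (hI : I.Nonempty) (hN : nb G I ≠ Finset.univ) :
    (nb G I).card ≠ I.card := by
  intro heq
  have h1 := eg_nb hreg I
  have h2 := eg_compl hreg (nb G I) I
  rw [eg_comm, h1, heq] at h2
  have h3 : eg G (nb G I) Iᶜ = 0 := by omega
  have hback : ∀ v ∈ nb G I, ∀ w, G.Adj v w → w ∈ I := by
    intro v hv w hvw
    by_contra hw
    unfold eg at h3
    rw [Finset.sum_eq_zero_iff] at h3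
    have := h3 v hv
    rw [Finset.card_eq_zero, Finset.filter_eq_empty_iff] at this
    exact this (Finset.mem_compl.2 hw) hvw
  have hfor : ∀ v ∈ I, ∀ w, G.Adj v w → w ∈ nb G I := fun v hv w h => mem_nb.2 ⟨v, hv, h⟩
  have hU : I ∪ nb G I = Finset.univ := by
    apply closed_eq_univ hconn (hI.mono Finset.subset_union_left)
    intro v hv w h
    rw [Finset.mem_union] at hv ⊢
    rcases hv with hv | hv
    · exact Or.inr (hfor v hv w h)
    · exact Or.inl (hback v hv w h)
  have hL : I ∩ nb G I = ∅ := by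
    by_contra hne
    have := closed_eq_univ hconn (Finset.nonempty_iff_ne_empty.2 hne) (by
      intro v hv w h
      rw [Finset.mem_inter] at hv ⊢
      exact ⟨hback v hv.2 w h, hfor v hv.1 w h⟩)
    apply hN
    rw [Finset.eq_univ_iff_forall] at this ⊢
    intro x
    exact (Finset.mem_inter.1 (this x)).2
  apply hnb
  refine ⟨SimpleGraph.Coloring.mk (fun v => if v ∈ I then (0 : Fin 2) else 1) ?_⟩
  intro v w h
  have key : ∀ x, x ∈ I → x ∈ nb G I → False := fun x h1 h2 => by
    have : x ∈ I ∩ nb G I := Finset.mem_inter.2 ⟨h1, h2⟩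
    simp [hL] at this
  by_cases hv : v ∈ I
  · have hw : w ∉ I := fun hw => key w hw (hfor v hv w h)
    simp [hv, hw]
  · have hv' : v ∈ nb G I := by
      have : v ∈ I ∪ nb G I := by rw [hU]; simp
      simpa [hv] using this
    have hw : w ∈ I := hback v hv' w h
    simp [hv, hw]

/-- Main block argument: a set of at least two vertices with small neighbourhood excess forces a
`K_{3,3}`. -/
lemma exists_dense_six (hreg : G.IsRegularOfDegree 5) (hconn : G.Connected)
    (hvt : VertexTransitive G) (hnb : ¬ G.Colorable 2)
    {Y : Finset V} (hY : 2 ≤ Y.card) (hYN : (nb G Y).card ≤ Y.card + 3)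
    (hYn : (nb G Y).card + 2 ≤ Fintype.card V) :
    ∃ U : Finset V, U.card = 6 ∧ eg G U Uᶜ ≤ 12 := by
  classical
  -- minimal excess
  let P : ℕ → Prop := fun k => ∃ I : Finset V, 2 ≤ I.card ∧ (nb G I).card + 2 ≤ Fintype.card V ∧
    (nb G I).card ≤ I.card + k
  have hP3 : P 3 := ⟨Y, hY, hYn, hYN⟩
  have hP : ∃ k, P k := ⟨3, hP3⟩
  obtain ⟨k, hk, hk3, hkmin⟩ : ∃ k, P k ∧ k ≤ 3 ∧ ∀ I : Finset V, 2 ≤ I.card →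
      (nb G I).card + 2 ≤ Fintype.card V → I.card + k ≤ (nb G I).card := by
    refine ⟨Nat.find hP, Nat.find_spec hP, Nat.find_min' hP hP3, ?_⟩
    intro I h1 h2
    by_contra hlt
    have hle := card_le_nb hreg I
    have := Nat.find_min' hP (m := (nb G I).card - I.card) ⟨I, h1, h2, by omega⟩
    omega
  -- minimal cardinality
  obtain ⟨I, hI2, hIn, hIk, hImin⟩ : ∃ I : Finset V, 2 ≤ I.card ∧
      (nb G I).card + 2 ≤ Fintype.card V ∧ (nb G I).card = I.card + k ∧
      ∀ J : Finset V, 2 ≤ J.card → (nb G J).card + 2 ≤ Fintype.card V →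
        (nb G J).card ≤ J.card + k → I.card ≤ J.card := by
    obtain ⟨I0, h1, h2, h3⟩ := hk
    obtain ⟨I, hI, hmin⟩ := Finset.exists_min_image
      (Finset.univ.filter (fun J : Finset V => 2 ≤ J.card ∧ (nb G J).card + 2 ≤ Fintype.card V ∧
        (nb G J).card ≤ J.card + k)) Finset.card ⟨I0, by simp [h1, h2, h3]⟩
    simp only [Finset.mem_filter, Finset.mem_univ, true_and] at hI hmin
    exact ⟨I, hI.1, hI.2.1, le_antisymm hI.2.2 (hkmin I hI.1 hI.2.1),
      fun J a b c => hmin J ⟨a, b, c⟩⟩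
  have hIne : I.Nonempty := Finset.card_pos.1 (by omega)
  -- dual set
  have hhalf : 2 * I.card + k ≤ Fintype.card V := by
    have hJc : ((nb G I)ᶜ).card = Fintype.card V - (nb G I).card := Finset.card_compl _
    have hsub : nb G ((nb G I)ᶜ) ⊆ Iᶜ := by
      intro w hw
      rw [mem_nb] at hw
      obtain ⟨v, hv, h⟩ := hw
      rw [Finset.mem_compl] at hv ⊢
      intro hwI
      exact hv (mem_nb.2 ⟨w, hwI, h.symm⟩)
    have hc := Finset.card_le_card hsub
    rw [Finset.card_compl] at hc
    have hle : I.card ≤ Fintype.card V := Finset.card_le_univ I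
    have := hImin ((nb G I)ᶜ) (by omega) (by omega) (by omega)
    omega
  -- block property
  have hblock : ∀ φ : G ≃g G, I.image φ ≠ I → Disjoint I (I.image φ) := by
    intro φ hne
    by_contra hd
    have hint : (I ∩ I.image φ).Nonempty := by
      rwa [Finset.not_disjoint_iff_nonempty_inter] at hd
    have hc : (I.image φ).card = I.card := Finset.card_image_of_injective _ φ.injective
    have hcN := card_nb_image φ I
    have hs := nb_submod (G := G) I (I.image φ)
    have h5 := five_le_nb hreg hint
    have hui := Finset.card_union_add_card_inter I (I.image φ)
    have hpos := hint.card_pos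
    have hlt : (I ∩ I.image φ).card < I.card := by
      refine Finset.card_lt_card ⟨Finset.inter_subset_left, fun h => hne ?_⟩
      have : I ⊆ I.image φ := h.trans Finset.inter_subset_right
      exact (Finset.eq_of_subset_of_card_le this hc.le).symm
    have hu := hkmin (I ∪ I.image φ) (by omega) (by omega)
    by_cases h2 : 2 ≤ (I ∩ I.image φ).card
    · have hle : (nb G (I ∩ I.image φ)).card ≤ (nb G I).card :=
        Finset.card_le_card ((nb_inter I _).trans Finset.inter_subset_left)
      have := hImin (I ∩ I.image φ) h2 (by omega) (by omega)
      omega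
    · omega
  have hkpos : k ≠ 0 := by
    intro h0
    refine nb_ne hreg hconn hnb hIne ?_ (by omega)
    intro h
    rw [h, Finset.card_univ] at hIn
    omega
  -- block system
  let 𝓑 : Finset (Finset V) := Finset.univ.filter (fun B => ∃ φ : G ≃g G, I.image φ = B)
  have hmem : ∀ B, B ∈ 𝓑 ↔ ∃ φ : G ≃g G, I.image φ = B := fun B => by simp [𝓑]
  have himg : ∀ (φ ψ : G ≃g G), (I.image φ).image ψ = I.image (φ.trans ψ) := by
    intro φ ψ
    rw [Finset.image_image]; rfl
  have hcardB : ∀ B ∈ 𝓑, B.card = I.card := by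
    intro B hB
    obtain ⟨φ, rfl⟩ := (hmem B).1 hB
    exact Finset.card_image_of_injective _ φ.injective
  have hcardNB : ∀ B ∈ 𝓑, (nb G B).card = I.card + k := by
    intro B hB
    obtain ⟨φ, rfl⟩ := (hmem B).1 hB
    rw [card_nb_image, hIk]
  have hdisj : ∀ B ∈ 𝓑, ∀ C ∈ 𝓑, B ≠ C → Disjoint B C := by
    intro B hB C hC hne
    obtain ⟨φ, rfl⟩ := (hmem B).1 hB
    obtain ⟨ψ, rfl⟩ := (hmem C).1 hC
    have h1 := hblock (ψ.trans φ.symm) (by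
      intro h
      apply hne
      have h2 := congrArg (Finset.image φ) h
      rw [← himg, Finset.image_image, Finset.image_image] at h2
      rw [← h2]
      ext x; simp)
    rw [Finset.disjoint_left] at h1 ⊢
    intro x hx hx'
    obtain ⟨a, ha, rfl⟩ := Finset.mem_image.1 hx
    obtain ⟨b, hb, hab⟩ := Finset.mem_image.1 hx'
    refine h1 ha (Finset.mem_image.2 ⟨b, hb, ?_⟩)
    simp [hab]
  have hcover : ∀ w : V, ∃ B ∈ 𝓑, w ∈ B := by
    intro w
    obtain ⟨u, hu⟩ := hIne
    obtain ⟨φ, hφ⟩ := hvt u w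
    exact ⟨I.image φ, (hmem _).2 ⟨φ, rfl⟩, Finset.mem_image.2 ⟨u, hu, hφ⟩⟩
  have hbU : 𝓑.biUnion (fun B => B) = Finset.univ := by
    rw [Finset.eq_univ_iff_forall]
    intro w
    obtain ⟨B, hB, hw⟩ := hcover w
    exact Finset.mem_biUnion.2 ⟨B, hB, hw⟩
  have hn : 𝓑.card * I.card = Fintype.card V := by
    rw [← Finset.card_univ, ← hbU, Finset.card_biUnion (fun B hB C hC h => hdisj B hB C hC h)]
    rw [Finset.sum_congr rfl hcardB]; simp
  let b : V → ℕ := fun v => (𝓑.filter (fun B => v ∈ nb G B)).card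
  have hb_le : ∀ v w, b v ≤ b w := by
    intro v w
    obtain ⟨φ, hφ⟩ := hvt v w
    refine Finset.card_le_card_of_injOn (fun B => B.image φ) ?_ ?_
    · intro B hB
      simp only [Finset.coe_filter, Set.mem_ofPred_eq] at hB ⊢
      obtain ⟨hB1, hB2⟩ := hB
      obtain ⟨ψ, rfl⟩ := (hmem B).1 hB1
      refine ⟨(hmem _).2 ⟨ψ.trans φ, (himg _ _).symm⟩, ?_⟩
      rw [nb_image, ← hφ]
      exact Finset.mem_image_of_mem _ hB2
    · exact (Finset.image_injective φ.injective).injOn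
  obtain ⟨u, hu⟩ := hIne
  have hb : ∀ v, b v = b u := fun v => le_antisymm (hb_le _ _) (hb_le _ _)
  have hcount : 𝓑.card * (I.card + k) = Fintype.card V * b u := by
    have h := Finset.sum_card_bipartiteAbove_eq_sum_card_bipartiteBelow (s := 𝓑)
      (t := (Finset.univ : Finset V)) (fun B v => v ∈ nb G B)
    simp only [Finset.bipartiteAbove, Finset.bipartiteBelow] at h
    rw [Finset.sum_congr rfl (g := fun _ => I.card + k) (by
      intro B hB
      rw [← hcardNB B hB]
      congr 1
      ext; simp)] at h
    rw [Finset.sum_congr rfl (g := fun _ => b u) (fun v _ => hb v)] at h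
    simpa using h
  have hBpos : 0 < 𝓑.card := by
    obtain ⟨B, hB, _⟩ := hcover u
    exact Finset.card_pos.2 ⟨B, hB⟩
  have hib : I.card + k = I.card * b u := by
    rw [← hn, mul_assoc] at hcount
    exact Nat.eq_of_mul_eq_mul_left hBpos hcount
  have h5 : 5 ≤ b u * I.card := by
    rw [← deg_filter hreg u]
    calc _ ≤ ((𝓑.filter (fun B => u ∈ nb G B)).biUnion id).card := by
            apply Finset.card_le_card
            intro w hw
            simp only [Finset.mem_filter, Finset.mem_univ, true_and] at hw
            obtain ⟨B, hB, hwB⟩ := hcover w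
            refine Finset.mem_biUnion.2 ⟨B, Finset.mem_filter.2 ⟨hB, ?_⟩, hwB⟩
            exact mem_nb.2 ⟨w, hwB, hw.symm⟩
      _ ≤ _ := Finset.card_biUnion_le_card_mul _ _ _ (fun B hB =>
            (hcardB B (Finset.mem_filter.1 hB).1).le)
  have hI3 : I.card = 3 ∧ k = 3 := by
    have h5' : 5 ≤ I.card + k := by rw [hib, mul_comm]; exact h5
    have hdvd : I.card ∣ k := by
      have : I.card ∣ I.card + k := ⟨_, hib⟩
      exact (Nat.dvd_add_right (dvd_refl _)).1 this
    have hle := Nat.le_of_dvd (by omega) hdvd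
    by_cases h2 : I.card = 2
    · rw [h2] at hdvd h5'
      omega
    · omega
  obtain ⟨hI3, rfl⟩ := hI3
  -- three vertices complete to `I`
  let T := (nb G I).filter (fun v => (I.filter (fun b => G.Adj v b)).card = 3)
  have hT : 3 ≤ T.card := by
    have h1 := eg_nb hreg I
    rw [eg_comm] at h1
    have h2 : eg G (nb G I) I ≤ ∑ v ∈ nb G I,
        (2 + if (I.filter (fun b => G.Adj v b)).card = 3 then 1 else 0) := by
      refine Finset.sum_le_sum fun v _ => ?_
      have : (I.filter (fun b => G.Adj v b)).card ≤ I.card :=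
        Finset.card_le_card (Finset.filter_subset _ _)
      split_ifs <;> omega
    rw [Finset.sum_add_distrib, ← Finset.card_filter] at h2
    simp only [Finset.sum_const, smul_eq_mul] at h2
    have : T.card = ((nb G I).filter
      (fun v => (I.filter (fun b => G.Adj v b)).card = 3)).card := rfl
    omega
  obtain ⟨T', hT', hT'3⟩ := Finset.exists_subset_card_eq hT
  have hadj : ∀ v ∈ T', ∀ w ∈ I, G.Adj v w := by
    intro v hv w hw
    have h := (Finset.mem_filter.1 (hT' hv)).2
    have : I.filter (fun b => G.Adj v b) = I :=
      Finset.eq_of_subset_of_card_le (Finset.filter_subset _ _) (by omega)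
    rw [← this] at hw
    exact (Finset.mem_filter.1 hw).2
  have hdis : Disjoint I T' := by
    rw [Finset.disjoint_left]
    intro v hv hv'
    exact G.loopless.irrefl v (hadj v hv' v hv)
  refine ⟨I ∪ T', by rw [Finset.card_union_of_disjoint hdis]; omega, ?_⟩
  have hIT : eg G I T' = 9 := by
    unfold eg
    rw [Finset.sum_congr rfl (g := fun _ => 3)]
    · simp [hI3]
    · intro v hv
      rw [Finset.filter_true_of_mem (fun w hw => (hadj w hw v hv).symm), hT'3]
  have hin : 18 ≤ eg G (I ∪ T') (I ∪ T') := by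
    rw [eg_union_left hdis, eg_union_right hdis, eg_union_right hdis, eg_comm T' I]
    omega
  have := eg_compl hreg (I ∪ T') (I ∪ T')
  rw [Finset.card_union_of_disjoint hdis] at this
  omega

end Count

end FC

namespace FC

section Cuts

set_option linter.unusedSectionVars false

variable {V : Type*} [Fintype V] [DecidableEq V] {G : SimpleGraph V} [DecidableRel G.Adj]

/-- Mantel-type bound on the number of inner adjacencies. -/
lemma mantel (htri : G.CliqueFree 3) (U : Finset V) (hU : U.Nonempty) :
    ∃ D : ℕ, D ≤ U.card ∧ eg G U U ≤ 2 * (D * (U.card - D)) := by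
  obtain ⟨v, hv, hmax⟩ := Finset.exists_max_image U
    (fun v => (U.filter (fun b => G.Adj v b)).card) hU
  set A := U.filter (fun b => G.Adj v b) with hA
  have hAU : A ⊆ U := Finset.filter_subset _ _
  have hle : A.card ≤ U.card := Finset.card_le_card hAU
  refine ⟨A.card, hle, ?_⟩
  have hsplit : eg G U U = eg G (U \ A) U + eg G A U := by
    unfold eg
    exact (Finset.sum_sdiff hAU).symm
  have h1 : eg G (U \ A) U ≤ (U \ A).card * A.card := by
    unfold eg
    rw [← smul_eq_mul]
    exact Finset.sum_le_card_nsmul _ _ _ (fun w hw => hmax w (Finset.mem_sdiff.1 hw).1)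
  have h2 : eg G A U ≤ A.card * (U \ A).card := by
    unfold eg
    rw [← smul_eq_mul]
    refine Finset.sum_le_card_nsmul _ _ _ (fun w hw => Finset.card_le_card ?_)
    intro x hx
    rw [Finset.mem_filter] at hx
    rw [Finset.mem_sdiff]
    refine ⟨hx.1, fun hxA => ?_⟩
    have hvw := (Finset.mem_filter.1 hw).2
    have hvx := (Finset.mem_filter.1 hxA).2
    exact htri {v, w, x} (SimpleGraph.is3Clique_triple_iff.2 ⟨hvw, hvx, hx.2⟩)
  rw [Finset.card_sdiff_of_subset hAU] at h1 h2
  rw [hsplit]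
  nlinarith [h1, h2, mul_comm A.card (U.card - A.card)]

lemma small_d (hreg : G.IsRegularOfDegree 5) (htri : G.CliqueFree 3) (U : Finset V)
    (h1 : 1 ≤ U.card) (h5 : U.card ≤ 5) :
    5 ≤ eg G U Uᶜ ∧ (2 ≤ U.card → 8 ≤ eg G U Uᶜ) ∧ (3 ≤ U.card → 11 ≤ eg G U Uᶜ) ∧
      (4 ≤ U.card → 12 ≤ eg G U Uᶜ) ∧ (5 ≤ U.card → 13 ≤ eg G U Uᶜ) := by
  obtain ⟨D, hD, hm⟩ := mantel htri U (Finset.card_pos.1 (by omega))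
  have hc := eg_compl hreg U U
  generalize eg G U Uᶜ = d at *
  generalize eg G U U = e at *
  generalize U.card = m at *
  interval_cases m <;> interval_cases D <;> omega

lemma eg_compl_symm (U : Finset V) : eg G Uᶜ Uᶜᶜ = eg G U Uᶜ := by
  rw [compl_compl, eg_comm]

lemma boundary_le (U : Finset V) : (edgeBoundary G (U : Set V)).ncard ≤ eg G U Uᶜ := by
  let P : Finset (V × V) := (U ×ˢ Uᶜ).filter (fun p => G.Adj p.1 p.2)
  have hP : P.card = eg G U Uᶜ := by
    unfold eg
    simp only [P]
    rw [Finset.card_filter, Finset.sum_product]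
    simp only [Finset.card_filter]
  rw [← hP]
  have hsub : edgeBoundary G (U : Set V) ⊆ ((P.image (fun p => s(p.1, p.2)) : Finset (Sym2 V)) :
      Set (Sym2 V)) := by
    rintro e ⟨he, x, hx, y, hy, rfl⟩
    rw [Finset.mem_coe, Finset.mem_image]
    refine ⟨(x, y), ?_, rfl⟩
    simp only [P, Finset.mem_filter, Finset.mem_product, Finset.mem_compl]
    exact ⟨⟨by simpa using hx, by simpa using hy⟩, by simpa using he⟩
  calc _ ≤ _ := Set.ncard_le_ncard hsub (Finset.finite_toSet _)
    _ = _ := Set.ncard_coe_finset _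
    _ ≤ _ := Finset.card_image_le

lemma no_small_piece (hreg : G.IsRegularOfDegree 5) (htri : G.CliqueFree 3)
    (U C : Finset V) (hU : 6 ≤ U.card) (hCU : C ⊆ U) (hCne : C.Nonempty) (hC : C.card < 6)
    (hcl : ∀ v ∈ C, ∀ w ∈ U \ C, ¬ G.Adj v w) (hd : eg G U Uᶜ < 14)
    (ih : 6 ≤ (U \ C).card → eg G (U \ C) (U \ C)ᶜ < eg G U Uᶜ → 14 ≤ eg G (U \ C) (U \ C)ᶜ) :
    False := by
  have hcard := Finset.card_sdiff_of_subset hCU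
  have h1 : eg G U Uᶜ = eg G (U \ C) Uᶜ + eg G C Uᶜ := by
    unfold eg
    exact (Finset.sum_sdiff hCU).symm
  have hz : eg G C (U \ C) = 0 := eg_eq_zero hcl
  have h2 : eg G C Cᶜ = eg G C Uᶜ := by
    have : Cᶜ = Uᶜ ∪ (U \ C) := by
      ext x
      have := @hCU x
      simp only [Finset.mem_compl, Finset.mem_union, Finset.mem_sdiff]
      tauto
    rw [this, eg_union_right, hz, add_zero]
    rw [Finset.disjoint_left]
    intro x hx hx'
    exact (Finset.mem_compl.1 hx) (Finset.mem_sdiff.1 hx').1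
  have h3 : eg G (U \ C) (U \ C)ᶜ = eg G (U \ C) Uᶜ := by
    have : (U \ C)ᶜ = Uᶜ ∪ C := by
      ext x
      simp only [Finset.mem_compl, Finset.mem_union, Finset.mem_sdiff]
      tauto
    rw [this, eg_union_right, eg_comm (U \ C) C, hz, add_zero]
    rw [Finset.disjoint_left]
    intro x hx hx'
    exact (Finset.mem_compl.1 hx) (hCU hx')
  have hpos := hCne.card_pos
  obtain ⟨a1, a2, a3, a4, a5⟩ := small_d hreg htri C (by omega) (by omega)
  by_cases h6 : 6 ≤ (U \ C).card
  · have := ih h6 (by omega)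
    omega
  · obtain ⟨b1, b2, b3, b4, b5⟩ := small_d hreg htri (U \ C) (by omega) (by omega)
    omega

lemma big_d (hreg : G.IsRegularOfDegree 5) (htri : G.CliqueFree 3)
    (h6 : lambdaS G 6 = 14) : ∀ (d : ℕ) (U : Finset V), eg G U Uᶜ = d → 6 ≤ U.card →
      U.card + 6 ≤ Fintype.card V → 14 ≤ eg G U Uᶜ := by
  intro d
  induction d using Nat.strong_induction_on with
  | _ d ih =>
  intro U hd hU hUn
  by_contra hlt
  push Not at hlt
  set F := edgeBoundary G (U : Set V) with hF
  have hstep : ∀ v w, (G.deleteEdges F).Adj v w → (v ∈ U ↔ w ∈ U) := by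
    intro v w h
    rw [SimpleGraph.deleteEdges_adj] at h
    by_contra hne
    apply h.2
    rw [hF]
    refine ⟨by simpa using h.1, ?_⟩
    by_cases hv : v ∈ U
    · exact ⟨v, by simpa using hv, w, by simpa using (fun hw => hne ⟨fun _ => hw, fun _ => hv⟩),
        rfl⟩
    · have hw : w ∈ U := by tauto
      exact ⟨w, by simpa using hw, v, by simpa using hv, Sym2.eq_swap⟩
  have hreach : ∀ v w, (G.deleteEdges F).Reachable v w → (v ∈ U ↔ w ∈ U) := by
    rintro v w ⟨p⟩
    induction p with
    | nil => rfl
    | cons h p ih => exact (hstep _ _ h).trans ih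
  have hcut : IsRestrictedEdgeCut G 6 F := by
    refine ⟨fun e he => he.1, ?_, ?_⟩
    · intro hc
      obtain ⟨u, hu⟩ : U.Nonempty := Finset.card_pos.1 (by omega)
      obtain ⟨w, hw⟩ : (Uᶜ).Nonempty := Finset.card_pos.1 (by rw [Finset.card_compl]; omega)
      exact (Finset.mem_compl.1 hw) ((hreach u w (hc.preconnected u w)).1 hu)
    · intro c
      by_contra hsm
      push Not at hsm
      obtain ⟨v, hv⟩ := c.nonempty_supp
      classical
      let C : Finset V := c.supp.toFinset
      have hCc : C.card = c.supp.ncard := (Set.ncard_eq_toFinset_card' _).symm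
      have hmemC : ∀ x, x ∈ C ↔ x ∈ c.supp := fun x => by simp [C]
      have hCv : ∀ x ∈ C, (v ∈ U ↔ x ∈ U) := by
        intro x hx
        rw [hmemC] at hx
        apply hreach
        rw [SimpleGraph.ConnectedComponent.mem_supp_iff] at hv hx
        exact SimpleGraph.ConnectedComponent.exact (hv.trans hx.symm)
      have hclosed : ∀ x ∈ C, ∀ w, (x ∈ U ↔ w ∈ U) → G.Adj x w → w ∈ C := by
        intro x hx w hxw hadj
        rw [hmemC] at hx ⊢
        have hA : (G.deleteEdges F).Adj x w := by
          rw [SimpleGraph.deleteEdges_adj]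
          refine ⟨hadj, ?_⟩
          rintro ⟨_, a, ha, b, hb, hab⟩
          have ha' : a ∈ U := by simpa using ha
          have hb' : b ∉ U := by simpa using hb
          rw [Sym2.eq_iff] at hab
          rcases hab with ⟨rfl, rfl⟩ | ⟨rfl, rfl⟩ <;> tauto
        rw [SimpleGraph.ConnectedComponent.mem_supp_iff] at hx ⊢
        rw [← hx]
        exact (SimpleGraph.ConnectedComponent.sound hA.reachable).symm
      have hvC : v ∈ C := (hmemC v).2 hv
      by_cases hvU : v ∈ U
      · refine no_small_piece hreg htri U C hU (fun x hx => (hCv x hx).1 hvU) ⟨v, hvC⟩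
          (by omega) ?_ hlt ?_
        · intro x hx w hw hadj
          rw [Finset.mem_sdiff] at hw
          exact hw.2 (hclosed x hx w ⟨fun _ => hw.1, fun _ => (hCv x hx).1 hvU⟩ hadj)
        · intro a b
          have := Finset.card_le_card (Finset.sdiff_subset (s := U) (t := C))
          exact ih _ (by omega) _ rfl a (by omega)
      · have hUc : (Uᶜ).card = Fintype.card V - U.card := Finset.card_compl U
        refine no_small_piece hreg htri Uᶜ C (by omega)
          (fun x hx => Finset.mem_compl.2 (fun h => hvU ((hCv x hx).2 h))) ⟨v, hvC⟩
          (by omega) ?_ (by rw [eg_compl_symm]; exact hlt) ?_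
        · intro x hx w hw hadj
          rw [Finset.mem_sdiff, Finset.mem_compl] at hw
          exact hw.2 (hclosed x hx w ⟨fun h => absurd ((hCv x hx).2 h) hvU,
            fun h => absurd h hw.1⟩ hadj)
        · intro a b
          rw [eg_compl_symm] at b
          have := Finset.card_le_card (Finset.sdiff_subset (s := Uᶜ) (t := C))
          exact ih _ (by omega) _ rfl a (by omega)
  have hle : lambdaS G 6 ≤ F.ncard := Nat.sInf_le ⟨F, hcut, rfl⟩
  have := boundary_le (G := G) U
  rw [← hF] at this
  omega

lemma twelve_le [Nonempty V] (h6 : lambdaS G 6 = 14) : 12 ≤ Fintype.card V := by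
  have hne : (Set.ncard '' {F | IsRestrictedEdgeCut G 6 F}).Nonempty := by
    apply Nat.nonempty_of_pos_sInf
    change 0 < lambdaS G 6
    omega
  obtain ⟨_, F, ⟨_, hnc, hF⟩, _⟩ := hne
  have : ¬ (G.deleteEdges F).Preconnected := fun h => hnc ⟨h⟩
  unfold SimpleGraph.Preconnected at this
  push Not at this
  obtain ⟨v, w, hvw⟩ := this
  have hdis : Disjoint ((G.deleteEdges F).connectedComponentMk v).supp
      ((G.deleteEdges F).connectedComponentMk w).supp := by
    rw [Set.disjoint_left]
    intro x hx hx'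
    rw [SimpleGraph.ConnectedComponent.mem_supp_iff] at hx hx'
    exact hvw (SimpleGraph.ConnectedComponent.exact (hx.symm.trans hx'))
  have h1 := hF ((G.deleteEdges F).connectedComponentMk v)
  have h2 := hF ((G.deleteEdges F).connectedComponentMk w)
  have h3 := Set.ncard_union_eq hdis (Set.toFinite _) (Set.toFinite _)
  have h4 := Set.ncard_le_ncard (Set.subset_univ
    (((G.deleteEdges F).connectedComponentMk v).supp ∪
      ((G.deleteEdges F).connectedComponentMk w).supp)) (Set.toFinite _)
  rw [Set.ncard_univ, Nat.card_eq_fintype_card] at h4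
  omega

lemma mid_d (hreg : G.IsRegularOfDegree 5) (htri : G.CliqueFree 3)
    (h6 : lambdaS G 6 = 14) (U : Finset V) (h3 : 3 ≤ U.card)
    (hn : U.card + 3 ≤ Fintype.card V) : 11 ≤ eg G U Uᶜ := by
  by_cases ha : U.card ≤ 5
  · exact (small_d hreg htri U (by omega) ha).2.2.1 h3
  by_cases hb : U.card + 6 ≤ Fintype.card V
  · have := big_d hreg htri h6 _ U rfl (by omega) hb
    omega
  · have hUc : (Uᶜ).card = Fintype.card V - U.card := Finset.card_compl U
    have := (small_d hreg htri Uᶜ (by omega) (by omega)).2.2.1 (by omega)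
    rwa [eg_compl_symm] at this

lemma exists_Y (hreg : G.IsRegularOfDegree 5) (htri : G.CliqueFree 3)
    (h6 : lambdaS G 6 = 14) {ι : Type*} [Fintype ι] (X : Finset V) (hX : 4 ≤ X.card)
    (C : ι → Finset V) (hodd : ∀ i, Odd (C i).card)
    (hdis : ∀ i j, i ≠ j → Disjoint (C i) (C j)) (hCX : ∀ i, Disjoint (C i) X)
    (hcl : ∀ i, ∀ v ∈ C i, ∀ w, G.Adj v w → w ∉ X → w ∈ C i)
    (hι : X.card ≤ Fintype.card ι + 2) :
    ∃ Y : Finset V, 2 ≤ Y.card ∧ (nb G Y).card ≤ Y.card + 3 ∧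
      (nb G Y).card + 2 ≤ Fintype.card V := by
  classical
  have hsum : ∑ i, eg G (C i) X ≤ 5 * X.card := by
    have h1 : eg G (Finset.univ.biUnion C) X = ∑ i, eg G (C i) X := by
      unfold eg
      exact Finset.sum_biUnion (fun i _ j _ h => hdis i j h)
    rw [← h1, eg_comm]
    exact eg_le hreg _ _
  have hd : ∀ i, eg G (C i) (C i)ᶜ ≤ eg G (C i) X := by
    intro i
    refine Finset.sum_le_sum fun v hv => Finset.card_le_card ?_
    intro w hw
    rw [Finset.mem_filter, Finset.mem_compl] at hw
    rw [Finset.mem_filter]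
    refine ⟨?_, hw.2⟩
    by_contra hwX
    exact hw.1 (hcl i v hv w hw.2 hwX)
  have hterm : ∀ i, 5 + 6 * (if (C i).card ≠ 1 then 1 else 0) ≤ eg G (C i) X := by
    intro i
    refine le_trans ?_ (hd i)
    obtain ⟨m, hm⟩ := hodd i
    have hle : (C i).card + X.card ≤ Fintype.card V := by
      rw [← Finset.card_union_of_disjoint (hCX i)]
      exact Finset.card_le_univ _
    split_ifs with h
    · have := mid_d hreg htri h6 (C i) (by omega) (by omega)
      omega
    · have := (small_d hreg htri (C i) (by omega) (by omega)).1
      omega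
  have hle := (Finset.sum_le_sum (fun i (_ : i ∈ Finset.univ) => hterm i)).trans hsum
  rw [Finset.sum_add_distrib, ← Finset.mul_sum, ← Finset.card_filter] at hle
  simp only [Finset.sum_const, smul_eq_mul, Finset.card_univ] at hle
  have hsplit := Finset.card_filter_add_card_filter_not (s := (Finset.univ : Finset ι))
    (fun i => (C i).card = 1)
  rw [Finset.card_univ] at hsplit
  simp only [← ne_eq] at hsplit
  let Y : Finset V := (Finset.univ.filter (fun i => (C i).card = 1)).biUnion C
  have hYc : Y.card = (Finset.univ.filter (fun i => (C i).card = 1)).card := by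
    simp only [Y]
    rw [Finset.card_biUnion (fun i _ j _ h => hdis i j h),
      Finset.sum_congr rfl (fun i hi => (Finset.mem_filter.1 hi).2)]
    simp
  have hYmem : ∀ v ∈ Y, ∃ i, (C i).card = 1 ∧ v ∈ C i := by
    intro v hv
    obtain ⟨i, hi, hvi⟩ := Finset.mem_biUnion.1 hv
    exact ⟨i, (Finset.mem_filter.1 hi).2, hvi⟩
  have hNX : nb G Y ⊆ X := by
    intro w hw
    obtain ⟨v, hv, hvw⟩ := mem_nb.1 hw
    obtain ⟨i, hi, hvi⟩ := hYmem v hv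
    by_contra hwX
    have hwi := hcl i v hvi w hvw hwX
    obtain ⟨z, hz⟩ := Finset.card_eq_one.1 hi
    rw [hz, Finset.mem_singleton] at hvi hwi
    exact hvw.ne (hvi.trans hwi.symm)
  have hYX : Disjoint Y X := by
    rw [Finset.disjoint_left]
    intro v hv hvX
    obtain ⟨i, _, hvi⟩ := hYmem v hv
    exact (Finset.disjoint_left.1 (hCX i)) hvi hvX
  have hNc := Finset.card_le_card hNX
  have hYn : Y.card + X.card ≤ Fintype.card V := by
    rw [← Finset.card_union_of_disjoint hYX]
    exact Finset.card_le_univ _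
  have h5 := five_le_nb hreg (I := Y) (Finset.card_pos.1 (by omega))
  exact ⟨Y, by omega, by omega, by omega⟩

lemma exists_Y_of_not_fc (hreg : G.IsRegularOfDegree 5) (htri : G.CliqueFree 3)
    (heven : Even (Fintype.card V)) (hnfc : ¬ PFactorCritical G 4)
    (h6 : lambdaS G 6 = 14) :
    ∃ Y : Finset V, 2 ≤ Y.card ∧ (nb G Y).card ≤ Y.card + 3 ∧
      (nb G Y).card + 2 ≤ Fintype.card V := by
  classical
  unfold PFactorCritical at hnfc
  push Not at hnfc
  obtain ⟨X0, hX0, hno⟩ := hnfc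
  have htut : ¬ ∀ u, ¬ (G.induce X0ᶜ).IsTutteViolator u := by
    rw [← SimpleGraph.tutte]
    rintro ⟨M, hM⟩
    exact hno M hM
  push Not at htut
  obtain ⟨u, hu⟩ := htut
  unfold SimpleGraph.IsTutteViolator at hu
  set D := ((⊤ : (G.induce X0ᶜ).Subgraph).deleteVerts u) with hD
  let X1 : Set V := X0 ∪ Subtype.val '' u
  have hdisX : Disjoint X0 (Subtype.val '' u) := by
    rw [Set.disjoint_left]
    rintro x hx ⟨y, _, rfl⟩
    exact y.2 hx
  have hX1 : X1.ncard = 4 + u.ncard := by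
    simp only [X1]
    rw [Set.ncard_union_eq hdisX (Set.toFinite _) (Set.toFinite _), hX0,
      Set.ncard_image_of_injective _ Subtype.val_injective]
  have hXc : X1.toFinset.card = 4 + u.ncard := by
    rw [← hX1]
    exact (Set.ncard_eq_toFinset_card' _).symm
  have hinj : Function.Injective (fun x : D.verts => (x.1.1 : V)) :=
    fun x y h => Subtype.ext (Subtype.ext h)
  have hverts : ∀ w : V, w ∉ X1 → ∃ x : D.verts, x.1.1 = w := by
    intro w hw
    have hw0 : w ∈ X0ᶜ := fun h => hw (Or.inl h)
    refine ⟨⟨⟨w, hw0⟩, ?_⟩, rfl⟩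
    simp only [hD, SimpleGraph.Subgraph.deleteVerts_verts, SimpleGraph.Subgraph.verts_top]
    exact ⟨trivial, fun h => hw (Or.inr ⟨_, h, rfl⟩)⟩
  have hnot : ∀ x : D.verts, x.1.1 ∉ X1 := by
    intro x hx
    rcases hx with hx | ⟨y, hy, hyx⟩
    · exact x.1.2 hx
    · have hxu : x.1 ∉ u := by
        have := x.2
        simp only [hD, SimpleGraph.Subgraph.deleteVerts_verts] at this
        exact this.2
      exact hxu ((Subtype.ext hyx : y = x.1) ▸ hy)
  have hcardv : Nat.card D.verts + X1.ncard = Fintype.card V := by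
    have hr : Set.range (fun x : D.verts => (x.1.1 : V)) = X1ᶜ := by
      ext w
      constructor
      · rintro ⟨x, rfl⟩
        exact hnot x
      · intro hw
        exact hverts w hw
    have h1 : Nat.card D.verts = (X1ᶜ).ncard := by
      rw [← hr, ← Set.image_univ, Set.ncard_image_of_injective _ hinj, Set.ncard_univ]
    have h2 := Set.ncard_add_ncard_compl X1
    rw [Nat.card_eq_fintype_card] at h2
    omega
  have hpar := SimpleGraph.odd_ncard_oddComponents D.coe
  have hge : u.ncard + 2 ≤ D.coe.oddComponents.ncard := by
    by_contra hlt
    have h1 : D.coe.oddComponents.ncard = u.ncard + 1 := by omega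
    rw [h1] at hpar
    rw [Nat.odd_iff, Nat.odd_iff] at hpar
    rw [Nat.even_iff] at heven
    omega
  let C : D.coe.oddComponents → Finset V :=
    fun c => ((fun x : D.verts => (x.1.1 : V)) '' c.1.supp).toFinset
  have hmemC : ∀ c v, v ∈ C c ↔ ∃ x : D.verts, x ∈ c.1.supp ∧ x.1.1 = v := by
    intro c v
    simp only [C, Set.mem_toFinset, Set.mem_image]
  have : Fintype D.coe.oddComponents := Fintype.ofFinite _
  refine exists_Y hreg htri h6 X1.toFinset (by omega) C ?_ ?_ ?_ ?_ ?_
  · intro c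
    have hc : Odd c.1.supp.ncard := c.2
    have : (C c).card = c.1.supp.ncard := by
      simp only [C]
      rw [← Set.ncard_eq_toFinset_card', Set.ncard_image_of_injective _ hinj]
    rwa [this]
  · intro c c' hne
    rw [Finset.disjoint_left]
    intro v hv hv'
    obtain ⟨x, hx, hxv⟩ := (hmemC _ _).1 hv
    obtain ⟨y, hy, hyv⟩ := (hmemC _ _).1 hv'
    have hxy : x = y := hinj (hxv.trans hyv.symm)
    subst hxy
    rw [SimpleGraph.ConnectedComponent.mem_supp_iff] at hx hy
    exact hne (Subtype.ext (hx.symm.trans hy))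
  · intro c
    rw [Finset.disjoint_left]
    intro v hv hvX
    obtain ⟨x, _, rfl⟩ := (hmemC _ _).1 hv
    exact hnot x (Set.mem_toFinset.1 hvX)
  · intro c v hv w hvw hw
    obtain ⟨x, hx, rfl⟩ := (hmemC _ _).1 hv
    obtain ⟨y, rfl⟩ := hverts w (fun h => hw (Set.mem_toFinset.2 h))
    refine (hmemC _ _).2 ⟨y, ?_, rfl⟩
    have hadj : D.coe.Adj x y := by
      rw [SimpleGraph.Subgraph.coe_adj]
      refine SimpleGraph.Subgraph.deleteVerts_adj.2 ?_
      have hx2 := x.2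
      have hy2 := y.2
      simp only [hD, SimpleGraph.Subgraph.deleteVerts_verts] at hx2 hy2
      refine ⟨hx2.1, hx2.2, hy2.1, hy2.2, ?_⟩
      simpa using hvw
    rw [SimpleGraph.ConnectedComponent.mem_supp_iff] at hx ⊢
    rw [← hx]
    exact (SimpleGraph.ConnectedComponent.sound hadj.reachable).symm
  · have : Fintype.card D.coe.oddComponents = D.coe.oddComponents.ncard := by
      rw [← Nat.card_eq_fintype_card, Nat.card_coe_set_eq]
    omega

end Cuts

end FC

/-- (Lemma 3.7) `G` connected vertex-transitive non-bipartite
triangle-free of degree 5 and even order, not 4-factor-critical, with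
`λ₆(G) = λ₇(G) = 14`. Then every `λ₇`-atom `S` of `G` satisfies `|S| ≥ 14`. -/
theorem statement15 {V : Type*} [Fintype V] [DecidableEq V]
    (G : SimpleGraph V) [DecidableRel G.Adj]
    (hconn : G.Connected) (hvt : VertexTransitive G) (hnb : ¬ G.Colorable 2)
    (htri : G.CliqueFree 3) (hreg : G.IsRegularOfDegree 5)
    (heven : Even (Fintype.card V)) (hnfc : ¬ PFactorCritical G 4)
    (h6 : lambdaS G 6 = 14) (h7 : lambdaS G 7 = 14)
    (S : Set V) (hS : IsLambdaAtom G 7 S) :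
    14 ≤ S.ncard := by
  exfalso
  obtain ⟨Y, hY1, hY2, hY3⟩ := FC.exists_Y_of_not_fc hreg htri heven hnfc h6
  obtain ⟨U, hU6, hUd⟩ := FC.exists_dense_six hreg hconn hvt hnb hY1 hY2 hY3
  have := hconn.nonempty
  have hn := FC.twelve_le (G := G) h6
  have := FC.big_d hreg htri h6 _ U rfl (by omega) (by omega)
  omega
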